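/- arXiv:2004.07452 — 2 statements merged into one kernel-verified Lean document; each statement's English description precedes it below -/
import Mathlib

section
/- The number of spanning trees in the cone over the Möbius ladder M(n) = C_{2n}(1, n) is 4(Tₙ(3/2) − 1)(Tₙ(5/2) + 1), where Tₙ is the Chebyshev polynomial of the first kind. -/
open SimpleGraph Polynomial Real

/-- The cone over a graph `G`. -/
def cone {V : Type*} (G : SimpleGraph V) : SimpleGraph (Option V) :=
  SimpleGraph.fromRel (fun x y => x = none ∨ ∃ a b, x = some a ∧ y = some b ∧ G.Adj a b)

/-- The number of spanning trees of `G`. -/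
noncomputable def numSpanningTrees {V : Type*} (G : SimpleGraph V) : ℕ :=
  Nat.card {H : SimpleGraph V // H ≤ G ∧ H.IsTree}

/-- The Möbius ladder `M(n)`: the circulant graph `C_{2n}(1, n)`. -/
def mobiusLadder (n : ℕ) : SimpleGraph (ZMod (2 * n)) :=
  circulantGraph {(1 : ZMod (2 * n)), (n : ZMod (2 * n))}


namespace MTT

variable {V : Type*}

/-- The parent function `f` has no cycles. -/
def Acyc (f : V → Option V) : Prop := ∃ d : Option V → ℕ, ∀ v, d (f v) < d (some v)

/-- The graph of a parent function. -/
def treeOf (f : V → Option V) : SimpleGraph (Option V) :=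
  SimpleGraph.fromRel (fun x y => ∃ v, x = some v ∧ y = f v)

/-- The row contributed by the arc `v → x`. -/
noncomputable def row [DecidableEq V] (v : V) (x : Option V) : V → ℂ :=
  fun w => (if v = w then 1 else 0) - (if x = some w then 1 else 0)

lemma det_acyc [Fintype V] [DecidableEq V] (f : V → Option V) (hf : Acyc f) :
    Matrix.det (Matrix.of fun v => row v (f v)) = 1 := by
  obtain ⟨d, hd⟩ := hf
  rw [← Matrix.det_transpose]
  have hne : ∀ v, f v ≠ some v := fun v h => by
    have := hd v
    rw [h] at this
    exact lt_irrefl _ this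
  have hb : Matrix.BlockTriangular (Matrix.of fun v => row v (f v)).transpose
      (fun v => d (some v)) := by
    intro i j hij
    dsimp only at hij
    have h1 : j ≠ i := by rintro rfl; exact lt_irrefl _ hij
    have h2 : f j ≠ some i := by
      intro h
      have := hd j
      rw [h] at this
      omega
    simp [row, h1, h2]
  rw [hb.det]
  refine Finset.prod_eq_one fun k _ => ?_
  have : Matrix.toSquareBlock (Matrix.of fun v => row v (f v)).transpose
      (fun v => d (some v)) k = 1 := by
    ext ⟨i, hi⟩ ⟨j, hj⟩
    have h2 : f j ≠ some i := by
      intro h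
      have := hd j
      rw [h] at this
      omega
    simp [Matrix.toSquareBlock_def, row, h2, Matrix.one_apply, eq_comm]
  rw [this, Matrix.det_one]

lemma det_not_acyc [Fintype V] [DecidableEq V] (f : V → Option V) (hf : ¬ Acyc f) :
    Matrix.det (Matrix.of fun v => row v (f v)) = 0 := by
  classical
  let F : Option V → Option V := fun x => x.bind f
  let R : Option V → Prop := fun x => ∃ k, F^[k] x = none
  have hR : ∀ v, R (f v) ↔ R (some v) := by
    intro v
    constructor
    · rintro ⟨k, hk⟩
      exact ⟨k + 1, hk⟩
    · rintro ⟨k, hk⟩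
      cases k with
      | zero => simp at hk
      | succ k => exact ⟨k, hk⟩
  have hN : R none := ⟨0, rfl⟩
  by_cases hall : ∀ x, R x
  · exfalso
    apply hf
    refine ⟨fun x => Nat.find (hall x), fun v => ?_⟩
    have h := Nat.find_spec (hall (some v))
    dsimp only
    generalize Nat.find (hall (some v)) = k at h
    cases k with
    | zero => simp at h
    | succ k => exact Nat.lt_succ_of_le (Nat.find_min' (hall (f v)) h)
  · push Not at hall
    obtain ⟨x, hx⟩ := hall
    obtain ⟨v0, rfl⟩ : ∃ v0, x = some v0 := by
      cases x with
      | none => exact absurd hN hx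
      | some v => exact ⟨v, rfl⟩
    rw [← Matrix.exists_mulVec_eq_zero_iff]
    refine ⟨fun v => if R (some v) then 0 else 1, ?_, ?_⟩
    · intro h
      have := congrFun h v0
      simp [hx] at this
    · ext v
      simp only [Matrix.mulVec, dotProduct, Matrix.of_apply, row, sub_mul, Finset.sum_sub_distrib,
        ite_mul, one_mul, zero_mul, Finset.sum_ite_eq, Finset.mem_univ, if_true, Pi.zero_apply]
      have := hR v
      cases hfv : f v with
      | none => rw [hfv] at this; simp [this.1 hN]
      | some w =>
        rw [hfv] at this
        simp [this]

lemma treeOf_adj (f : V → Option V) (hf : Acyc f) (v : V) : (treeOf f).Adj (some v) (f v) := by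
  obtain ⟨d, hd⟩ := hf
  refine ⟨fun h => ?_, Or.inl ⟨v, rfl, rfl⟩⟩
  have := hd v
  rw [← h] at this
  exact lt_irrefl _ this

lemma treeOf_connected (f : V → Option V) (hf : Acyc f) : (treeOf f).Connected := by
  obtain ⟨d, hd⟩ := id hf
  have key : ∀ k, ∀ x, d x ≤ k → (treeOf f).Reachable x none := by
    intro k
    induction k with
    | zero =>
      intro x hx
      cases x with
      | none => rfl
      | some v => have := hd v; omega
    | succ k ih =>
      intro x hx
      cases x with
      | none => rfl
      | some v =>
        have := hd v
        exact (treeOf_adj f hf v).reachable.trans (ih _ (by omega))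
  have : Nonempty (Option V) := ⟨none⟩
  exact ⟨fun x y => (key _ x le_rfl).trans (key _ y le_rfl).symm⟩

lemma treeOf_isTree [Fintype V] (f : V → Option V) (hf : Acyc f) : (treeOf f).IsTree := by
  have hc := treeOf_connected f hf
  rw [isTree_iff_connected_and_card]
  refine ⟨hc, le_antisymm ?_ hc.card_vert_le_card_edgeSet_add_one⟩
  have hs : (treeOf f).edgeSet ⊆ Set.range (fun v : V => s(some v, f v)) := by
    intro e
    induction e with
    | _ x y =>
      rintro ⟨-, ⟨v, rfl, rfl⟩ | ⟨v, rfl, rfl⟩⟩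
      · exact ⟨v, rfl⟩
      · exact ⟨v, Sym2.eq_swap⟩
  have h1 : Nat.card (treeOf f).edgeSet ≤ Nat.card V := by
    refine (Nat.card_mono (Set.finite_range _) hs).trans ?_
    exact Finite.card_range_le _
  simp only [Nat.card_eq_fintype_card, Fintype.card_option] at *
  omega

lemma treeOf_inj (f g : V → Option V) (hg : Acyc g) (h : treeOf f = treeOf g) :
    f = g := by
  obtain ⟨d, hd⟩ := id hg
  have key : ∀ k, ∀ v, d (some v) ≤ k → f v = g v := by
    intro k
    induction k with
    | zero => intro v hv; have := hd v; omega
    | succ k ih =>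
      intro v hv
      by_contra hne
      have hadj := treeOf_adj g hg v
      rw [← h] at hadj
      obtain ⟨-, ⟨w, hw, hw'⟩ | ⟨w, hw, hw'⟩⟩ := hadj
      · cases hw; exact hne hw'.symm
      · have h1 := hd v
        have h2 := hd w
        rw [hw] at h1
        have h3 := ih w (by omega)
        rw [← h3, ← hw'] at h2
        omega
  funext v
  exact key _ v le_rfl

lemma exists_parent (H : SimpleGraph (Option V)) (hH : H.IsTree) :
    ∃ f : V → Option V, Acyc f ∧ treeOf f = H := by
  have hc := hH.connected
  have : ∀ v : V, ∃ x, H.Adj (some v) x ∧ H.dist x none < H.dist (some v) none := by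
    intro v
    obtain ⟨p, hp⟩ := hc.exists_walk_length_eq_dist (some v) none
    cases p with
    | cons hadj q =>
      refine ⟨_, hadj, ?_⟩
      have := SimpleGraph.dist_le q
      simp at hp
      omega
  choose f hf hd using this
  have ha : Acyc f := ⟨fun x => H.dist x none, hd⟩
  refine ⟨f, ha, ?_⟩
  have hle : treeOf f ≤ H := by
    intro x y
    rintro ⟨-, ⟨v, rfl, rfl⟩ | ⟨v, rfl, rfl⟩⟩
    · exact hf v
    · exact (hf v).symm
  exact le_antisymm hle ((isTree_iff_minimal_connected.1 hH).2 (treeOf_connected f ha) hle)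

theorem matrix_tree [Fintype V] [DecidableEq V] (G : SimpleGraph (Option V))
    [DecidableRel G.Adj] :
    (numSpanningTrees G : ℂ) =
      Matrix.det (Matrix.of fun v => ∑ x with G.Adj (some v) x, row v x) := by
  classical
  have h := (Matrix.detRowAlternating (R := ℂ) (n := V)).toMultilinearMap.map_sum_finset
    (fun v x => row v x) (fun v => Finset.univ.filter fun x => G.Adj (some v) x)
  have h' : Matrix.det (Matrix.of fun v => ∑ x with G.Adj (some v) x, row v x) =
      ∑ f ∈ Fintype.piFinset (fun v => Finset.univ.filter fun x => G.Adj (some v) x),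
        Matrix.det (Matrix.of fun v => row v (f v)) := h
  rw [h', Finset.sum_congr rfl (g := fun f => if Acyc f then (1 : ℂ) else 0)]
  swap
  · intro f _
    split_ifs with hf
    · exact det_acyc f hf
    · exact det_not_acyc f hf
  rw [Finset.sum_boole, Nat.cast_inj, ← Fintype.card_coe, ← Nat.card_eq_fintype_card]
  symm
  refine Nat.card_eq_of_bijective (fun f => ⟨treeOf f.1, ?_, ?_⟩) ⟨?_, ?_⟩
  · have hf := f.2
    simp only [Finset.mem_filter, Fintype.mem_piFinset, Finset.mem_univ, true_and] at hf
    rintro x y ⟨-, ⟨v, rfl, rfl⟩ | ⟨v, rfl, rfl⟩⟩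
    · exact hf.1 v
    · exact (hf.1 v).symm
  · exact treeOf_isTree _ (Finset.mem_filter.1 f.2).2
  · intro f g hfg
    exact Subtype.ext (treeOf_inj _ _ (Finset.mem_filter.1 g.2).2
      (congrArg Subtype.val hfg))
  · rintro ⟨H, hle, hH⟩
    obtain ⟨f, hf, rfl⟩ := exists_parent H hH
    refine ⟨⟨f, ?_⟩, rfl⟩
    simp only [Finset.mem_filter, Fintype.mem_piFinset, Finset.mem_univ, true_and]
    exact ⟨fun v => hle (treeOf_adj f hf v), hf⟩

end MTT

namespace MTT

lemma two_T (c : ℝ) (x : ℂ) (hx : x ≠ 0) (hc : x + x⁻¹ = c) (n : ℕ) :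
    ((2 * (Polynomial.Chebyshev.T ℝ (n : ℤ)).eval (c / 2) : ℝ) : ℂ) = x ^ n + (x ^ n)⁻¹ := by
  induction n using Nat.twoStepInduction with
  | zero => simp; norm_num
  | one => simp [hc]; ring
  | more n h1 h2 =>
    have : Polynomial.Chebyshev.T ℝ ((n + 2 : ℕ) : ℤ) = 2 * X * Polynomial.Chebyshev.T ℝ ((n + 1 : ℕ) : ℤ)
        - Polynomial.Chebyshev.T ℝ (n : ℤ) := by
      push_cast
      exact Polynomial.Chebyshev.T_add_two ℝ n
    rw [this]
    simp only [eval_sub, eval_mul, eval_ofNat, eval_X]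
    push_cast at h1 h2 ⊢
    have : (2 : ℂ) * (2 * (c / 2) * (Polynomial.Chebyshev.T ℂ ((n : ℤ) + 1)).eval ((c : ℂ) / 2)
        - (Polynomial.Chebyshev.T ℂ (n : ℤ)).eval ((c : ℂ) / 2)) =
        (x + x⁻¹) * (x ^ (n + 1) + (x ^ (n + 1))⁻¹) - (x ^ n + (x ^ n)⁻¹) := by
      rw [← h1, ← h2, hc]; ring
    rw [this]
    field_simp
    ring

lemma exists_x (c : ℝ) : ∃ x : ℂ, x ≠ 0 ∧ x + x⁻¹ = c := by
  obtain ⟨s, hs⟩ := IsAlgClosed.exists_pow_nat_eq ((c : ℂ) ^ 2 - 4) (n := 2) (by norm_num)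
  have h0 : (c + s) / 2 ≠ 0 := by
    intro h
    have : s = -c := by linear_combination 2 * h
    rw [this] at hs
    have : (4 : ℂ) = 0 := by linear_combination hs
    norm_num at this
  refine ⟨(c + s) / 2, h0, ?_⟩
  have : ((c + s) / 2)⁻¹ = (c - s) / 2 := by
    apply inv_eq_of_mul_eq_one_right
    linear_combination -hs / 4
  rw [this]
  ring

lemma prod_eq (n : ℕ) (hn : 0 < n) (η y : ℂ) (hη : IsPrimitiveRoot η n) (hy : y ≠ 0) (c : ℝ) :
    ∏ i ∈ Finset.range n, ((c : ℂ) - η ^ i * y - (η ^ i * y)⁻¹) =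
      ((2 * (Polynomial.Chebyshev.T ℝ (n : ℤ)).eval (c / 2) : ℝ) : ℂ) - (y ^ n + (y ^ n)⁻¹) := by
  obtain ⟨x, hx, hc⟩ := exists_x c
  rw [two_T c x hx hc n]
  have hη0 : η ≠ 0 := hη.ne_zero hn.ne'
  have e1 : ∀ i ∈ Finset.range n, ((c : ℂ) - η ^ i * y - (η ^ i * y)⁻¹) =
      (x - η ^ i * y) * (x - η⁻¹ ^ i * y⁻¹) * x⁻¹ := by
    intro i _
    rw [← hc, inv_pow]
    have := pow_ne_zero i hη0
    field_simp
    ring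
  rw [Finset.prod_congr rfl e1, Finset.prod_mul_distrib, Finset.prod_mul_distrib]
  have h1 := congrArg (Polynomial.eval x) (X_pow_sub_C_eq_prod hη hn (rfl : y ^ n = y ^ n))
  have h2 := congrArg (Polynomial.eval x) (X_pow_sub_C_eq_prod hη.inv hn (rfl : y⁻¹ ^ n = y⁻¹ ^ n))
  simp only [eval_sub, eval_pow, eval_X, eval_C, eval_prod] at h1 h2
  rw [← h1, ← h2, Finset.prod_const, Finset.card_range]
  have := pow_ne_zero n hy
  have := pow_ne_zero n hx
  simp only [inv_pow]
  field_simp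
  ring

lemma prod_range_two_mul (n : ℕ) (g : ℕ → ℂ) :
    ∏ i ∈ Finset.range (2 * n), g i =
      (∏ i ∈ Finset.range n, g (2 * i)) * ∏ i ∈ Finset.range n, g (2 * i + 1) := by
  induction n with
  | zero => simp
  | succ n ih =>
    rw [show 2 * (n + 1) = 2 * n + 1 + 1 by ring, Finset.prod_range_succ, Finset.prod_range_succ,
      ih, Finset.prod_range_succ, Finset.prod_range_succ]
    ring

/-- Row form of the reduced Laplacian. -/
noncomputable def lap (n : ℕ) : Matrix (ZMod (2 * n)) (ZMod (2 * n)) ℂ :=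
  Matrix.of fun v w => 4 * (if w = v then 1 else 0) - (if w = v + 1 then 1 else 0)
    - (if w = v - 1 then 1 else 0) - (if w = v + n then 1 else 0)

lemma det_lap (n : ℕ) [NeZero (2 * n)] (ζ : ℂ) (hζ : IsPrimitiveRoot ζ (2 * n)) :
    (lap n).det = ∏ i ∈ Finset.range (2 * n), (4 - ζ ^ i - (ζ ^ i)⁻¹ - ζ ^ (n * i)) := by
  let χ := AddChar.zmodChar (2 * n) hζ.pow_eq_one
  have hχ : χ.IsPrimitive := AddChar.zmodChar_primitive_of_primitive_root _ hζ
  let F : Matrix (ZMod (2 * n)) (ZMod (2 * n)) ℂ := Matrix.of fun v k => χ (v * k)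
  let F' : Matrix (ZMod (2 * n)) (ZMod (2 * n)) ℂ := Matrix.of fun k v => χ (-(k * v))
  let D : ZMod (2 * n) → ℂ := fun k => 4 - χ k - χ (-k) - χ (n * k)
  have hF : F * F' = (Fintype.card (ZMod (2 * n)) : ℂ) • 1 := by
    ext u v
    simp only [Matrix.mul_apply, F, F', Matrix.of_apply, ← AddChar.map_add_eq_mul]
    have := AddChar.sum_mulShift (u - v) hχ
    rw [Finset.sum_congr rfl (g := fun k => χ (k * (u - v))) (fun k _ => by congr 1; ring), this]
    simp [Matrix.one_apply, sub_eq_zero]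
  have hFdet : F.det ≠ 0 := by
    intro h0
    have := congrArg Matrix.det hF
    rw [Matrix.det_mul, h0, zero_mul, Matrix.det_smul, Matrix.det_one, mul_one] at this
    exact pow_ne_zero _ (Nat.cast_ne_zero.2 Fintype.card_ne_zero) this.symm
  have hM : lap n * F = F * Matrix.diagonal D := by
    ext v k
    rw [Matrix.mul_diagonal]
    simp only [Matrix.mul_apply, lap, F, Matrix.of_apply, sub_mul, Finset.sum_sub_distrib, mul_assoc,
      ← Finset.mul_sum, ite_mul, one_mul, zero_mul, Finset.sum_ite_eq', Finset.mem_univ, if_true, D]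
    rw [show v * k - k = v * k + -k by ring, show (v + 1) * k = v * k + k by ring,
      show (v + n) * k = v * k + n * k by ring]
    simp only [AddChar.map_add_eq_mul]
    ring
  have hdet : (lap n).det = ∏ k, D k := by
    have := congrArg Matrix.det hM
    rw [Matrix.det_mul, Matrix.det_mul, Matrix.det_diagonal, mul_comm] at this
    exact mul_left_cancel₀ hFdet this
  rw [hdet]
  have hD : ∀ k : ZMod (2 * n), D k = 4 - ζ ^ k.val - (ζ ^ k.val)⁻¹ - ζ ^ (n * k.val) := by
    intro k
    have h1 : χ k = ζ ^ k.val := rfl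
    have h2 : χ (n * k) = ζ ^ (n * k.val) := by
      have := AddChar.zmodChar_apply' hζ.pow_eq_one (n * k.val)
      rw [← this]
      push_cast
      rw [ZMod.natCast_zmod_val]
    simp only [D, AddChar.map_neg_eq_inv, h1, h2]
  rw [Finset.prod_congr rfl fun k _ => hD k]
  refine Finset.prod_nbij ZMod.val ?_ ?_ ?_ ?_
  · intro k _; simpa using ZMod.val_lt k
  · exact (ZMod.val_injective _).injOn
  · intro i hi
    have hi' : i < 2 * n := by simpa using hi
    exact ⟨(i : ZMod (2 * n)), by simp, ZMod.val_cast_of_lt hi'⟩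
  · intro k _; rfl

lemma det_lap_eq (n : ℕ) (hn : 2 ≤ n) [NeZero (2 * n)] :
    (lap n).det = ((4 * ((Polynomial.Chebyshev.T ℝ (n : ℤ)).eval (3 / 2 : ℝ) - 1) *
        ((Polynomial.Chebyshev.T ℝ (n : ℤ)).eval (5 / 2 : ℝ) + 1) : ℝ) : ℂ) := by
  have hζ := Complex.isPrimitiveRoot_exp (2 * n) (by omega)
  generalize Complex.exp (2 * π * Complex.I / (2 * n : ℕ)) = ζ at hζ
  have hη : IsPrimitiveRoot (ζ ^ 2) n := hζ.pow (by omega) rfl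
  have hm : ζ ^ n = -1 := (hζ.pow (a := n) (b := 2) (by omega) (by ring)).eq_neg_one_of_two_right
  have hζ0 : ζ ≠ 0 := hζ.ne_zero (by omega)
  rw [det_lap n ζ hζ, prod_range_two_mul]
  have a1 := prod_eq n (by omega) (ζ ^ 2) 1 hη one_ne_zero 3
  have a2 := prod_eq n (by omega) (ζ ^ 2) ζ hη hζ0 5
  rw [Finset.prod_congr rfl (g := fun i => ((3 : ℝ) : ℂ) - (ζ ^ 2) ^ i * 1 - ((ζ ^ 2) ^ i * 1)⁻¹), a1]
  · rw [Finset.prod_congr rfl (g := fun i => ((5 : ℝ) : ℂ) - (ζ ^ 2) ^ i * ζ - ((ζ ^ 2) ^ i * ζ)⁻¹), a2]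
    · rw [hm]
      push_cast
      norm_num
      ring
    · intro i _
      rw [pow_mul ζ n, hm, pow_succ, pow_succ, pow_mul, pow_mul]
      push_cast
      norm_num
      ring
  · intro i _
    rw [pow_mul ζ n, hm, pow_mul, pow_mul]
    push_cast
    norm_num
    ring

lemma cone_rows (n : ℕ) (hn : 2 ≤ n) [NeZero (2 * n)]
    [DecidableRel (cone (mobiusLadder n)).Adj] :
    (Matrix.of fun v => ∑ x with (cone (mobiusLadder n)).Adj (some v) x, row v x) = lap n := by
  have h1 : (1 : ZMod (2 * n)) ≠ 0 := by
    intro h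
    have := (ZMod.natCast_eq_zero_iff 1 (2 * n)).1 (by simpa using h)
    have := Nat.le_of_dvd (by omega) this
    omega
  have h2 : (n : ZMod (2 * n)) ≠ 0 := by
    intro h
    have := (ZMod.natCast_eq_zero_iff n (2 * n)).1 h
    have := Nat.le_of_dvd (by omega) this
    omega
  have h3 : (n : ZMod (2 * n)) + n = 0 := by
    have := ZMod.natCast_self (2 * n)
    push_cast at this
    rw [← this]; ring
  have h4 : (1 : ZMod (2 * n)) + 1 ≠ 0 := by
    intro h
    have := (ZMod.natCast_eq_zero_iff 2 (2 * n)).1 (by push_cast; rw [← h]; norm_num)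
    have := Nat.le_of_dvd (by omega) this
    omega
  have h5 : (n : ZMod (2 * n)) ≠ 1 := by
    intro h
    have h' : ((n : ℕ) : ZMod (2 * n)) = ((1 : ℕ) : ZMod (2 * n)) := by simpa using h
    rw [ZMod.natCast_eq_natCast_iff'] at h'
    rw [Nat.mod_eq_of_lt (by omega), Nat.mod_eq_of_lt (by omega)] at h'
    omega
  have h6 : (n : ZMod (2 * n)) + 1 ≠ 0 := by
    intro h
    exact h5 (by linear_combination h3 - h)
  have hadj : ∀ v, (Finset.univ.filter fun x => (cone (mobiusLadder n)).Adj (some v) x) =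
      {none, some (v + 1), some (v - 1), some (v + n)} := by
    intro v
    ext x
    cases x with
    | none => rw [Finset.mem_filter]; simp [cone]
    | some w =>
      simp only [cone, mobiusLadder, fromRel_adj, circulantGraph_adj, Finset.mem_filter,
        Finset.mem_univ, true_and, Finset.mem_insert, Finset.mem_singleton, Option.some.injEq,
        reduceCtorEq, false_or, Set.mem_insert_iff, Set.mem_singleton_iff, ne_eq]
      constructor
      · rintro ⟨-, ⟨a, b, rfl, rfl, h⟩ | ⟨a, b, rfl, rfl, h⟩⟩ <;>
        · obtain ⟨-, (h | h) | (h | h)⟩ := h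
          all_goals first
            | exact Or.inl (by linear_combination h)
            | exact Or.inl (by linear_combination -h)
            | exact Or.inr (Or.inl (by linear_combination h))
            | exact Or.inr (Or.inl (by linear_combination -h))
            | exact Or.inr (Or.inr (by linear_combination h))
            | exact Or.inr (Or.inr (by linear_combination -h - h3))
      · rintro (rfl | rfl | rfl)
        · refine ⟨by simpa using h1, Or.inl ⟨_, _, rfl, rfl, by simpa using h1, Or.inr (Or.inl ?_)⟩⟩
          ring
        · refine ⟨?_, Or.inl ⟨_, _, rfl, rfl, ?_, Or.inl (Or.inl ?_)⟩⟩
          · intro h; exact h1 (by linear_combination h)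
          · intro h; exact h1 (by linear_combination h)
          · ring
        · refine ⟨by simpa using h2, Or.inl ⟨_, _, rfl, rfl, by simpa using h2, Or.inr (Or.inr ?_)⟩⟩
          ring
  ext v w
  rw [Matrix.of_apply, hadj v, Finset.sum_insert, Finset.sum_insert, Finset.sum_insert,
    Finset.sum_singleton]
  · simp only [Pi.add_apply, row, lap, Matrix.of_apply, Option.some.injEq, reduceCtorEq, if_false]
    simp only [eq_comm (b := w)]
    ring
  · simp only [Finset.mem_singleton, Option.some.injEq]
    intro h; exact h6 (by linear_combination -h)
  · simp only [Finset.mem_insert, Finset.mem_singleton, Option.some.injEq, not_or]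
    refine ⟨fun h => h4 (by linear_combination h), fun h => h5 (by linear_combination -h)⟩
  · simp

end MTT


theorem numSpanningTrees_cone_mobiusLadder (n : ℕ) (hn : 2 ≤ n) :
    (numSpanningTrees (cone (mobiusLadder n)) : ℝ) =
      4 * ((Polynomial.Chebyshev.T ℝ (n : ℤ)).eval (3 / 2 : ℝ) - 1) *
        ((Polynomial.Chebyshev.T ℝ (n : ℤ)).eval (5 / 2 : ℝ) + 1) := by
  classical
  have : NeZero (2 * n) := ⟨by omega⟩
  have h := MTT.matrix_tree (cone (mobiusLadder n))
  rw [MTT.cone_rows n hn, MTT.det_lap_eq n hn] at h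
  exact_mod_cast h
end

section
/- The number of spanning trees in the cone over the prism graph Pr(n) (the circulant cobordism of two n-cycles, i.e., Cₙ × K₂) is 4(Tₙ(3/2) − 1)(Tₙ(5/2) − 1), where Tₙ is the Chebyshev polynomial of the first kind. -/
open SimpleGraph Polynomial Real

/-- The prism graph `Pr(n)`: the Cartesian (box) product of the cycle `Cₙ` with an edge
`K₂`, i.e. two copies of `Cₙ` with corresponding vertices joined by edges. -/
def prism (n : ℕ) : SimpleGraph (Fin n × Fin 2) :=
  (cycleGraph n) □ (⊤ : SimpleGraph (Fin 2))

/-- Row vector attached to an arc `v → o`. -/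
noncomputable def arcMat {V : Type*} [DecidableEq V] (v : V) (o : Option V) (w : V) : ℝ :=
  (if w = v then 1 else 0) - (if o = some w then 1 else 0)

/-- `f` is a rooted parent function. -/
def Rooted {V : Type*} (f : V → Option V) : Prop :=
  ∃ d : Option V → ℕ, ∀ v, d (f v) < d (some v)

/-- graph of a parent function. -/
def parentGraph {V : Type*} (f : V → Option V) : SimpleGraph (Option V) :=
  SimpleGraph.fromRel (fun x y => ∃ v, x = some v ∧ y = f v)

lemma det_arc_rooted {V : Type*} [Fintype V] [DecidableEq V] (f : V → Option V)
    (hf : Rooted f) : (Matrix.of fun v w => arcMat v (f v) w).det = 1 := by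
  obtain ⟨d, hd⟩ := hf
  have ht : (Matrix.of fun v w => arcMat v (f v) w).BlockTriangular
      (fun v => OrderDual.toDual (d (some v))) := by
    intro i j hij
    have hij' : d (some i) < d (some j) := hij
    have h1 : j ≠ i := by rintro rfl; omega
    have h2 : f i ≠ some j := by
      intro h
      have := hd i
      rw [h] at this
      omega
    simp [arcMat, h1, h2]
  rw [ht.det]
  apply Finset.prod_eq_one
  intro a _
  suffices h : (Matrix.of fun v w => arcMat v (f v) w).toSquareBlock
      (fun v => OrderDual.toDual (d (some v))) a = 1 by rw [h, Matrix.det_one]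
  ext ⟨i, hi⟩ ⟨j, hj⟩
  have h2 : f i ≠ some j := by
    intro h
    have h3 := hd i
    rw [h] at h3
    have : d (some i) = d (some j) := OrderDual.toDual.injective (hi.trans hj.symm)
    omega
  simp [Matrix.toSquareBlock_def, arcMat, h2, Matrix.one_apply, eq_comm]

lemma det_arc_not_rooted {V : Type*} [Fintype V] [DecidableEq V] (f : V → Option V)
    (hf : ¬ Rooted f) : (Matrix.of fun v w => arcMat v (f v) w).det = 0 := by
  classical
  let F : Option V → Option V := fun o => o.bind f
  let P : Option V → Prop := fun o => ∃ n, F^[n] o = none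
  have hP0 : P none := ⟨0, rfl⟩
  have hPs : ∀ v, P (some v) ↔ P (f v) := by
    intro v
    constructor
    · rintro ⟨n, hn⟩
      cases n with
      | zero => simp at hn
      | succ n => exact ⟨n, by simpa [F] using hn⟩
    · rintro ⟨n, hn⟩
      exact ⟨n + 1, by simpa [F] using hn⟩
  rw [← Matrix.exists_mulVec_eq_zero_iff]
  refine ⟨fun v => if P (some v) then 0 else 1, ?_, ?_⟩
  · intro h0
    apply hf
    have hall : ∀ o, P o := by
      intro o
      cases o with
      | none => exact hP0
      | some v =>
        by_contra h
        have := congrFun h0 v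
        simp [h] at this
    refine ⟨fun o => Nat.find (hall o), fun v => ?_⟩
    have h1 := Nat.find_spec (hall (some v))
    have hne : Nat.find (hall (some v)) ≠ 0 := by
      intro h
      rw [h] at h1
      simp at h1
    obtain ⟨k, hk⟩ := Nat.exists_eq_succ_of_ne_zero hne
    rw [hk] at h1
    have : Nat.find (hall (f v)) ≤ k := Nat.find_min' _ (by simpa [F] using h1)
    show Nat.find (hall (f v)) < Nat.find (hall (some v))
    omega
  · have hmul : ∀ x : V → ℝ, ∀ v, ((Matrix.of fun v w => arcMat v (f v) w).mulVec x) v =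
        x v - (f v).elim 0 x := by
      intro x v
      cases hv : f v with
      | none => simp [Matrix.mulVec, dotProduct, arcMat, hv]
      | some w => simp [Matrix.mulVec, dotProduct, arcMat, hv, sub_mul, Finset.sum_sub_distrib]
    ext v
    rw [hmul]
    have := hPs v
    cases hv : f v with
    | none =>
      rw [hv] at this
      simp [this, hP0]
    | some w =>
      rw [hv] at this
      simp [this]

lemma det_sum_arcs {V : Type*} [Fintype V] [DecidableEq V] (G : SimpleGraph (Option V))
    [DecidableRel G.Adj] :
    (Matrix.of fun v w => ∑ o : Option V, if G.Adj (some v) o then arcMat v o w else 0).det =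
      (Nat.card {f : V → Option V // (∀ v, G.Adj (some v) (f v)) ∧ Rooted f} : ℝ) := by
  classical
  have h1 := (Matrix.detRowAlternating (n := V) (R := ℝ)).toMultilinearMap.map_sum
    (fun (v : V) (o : Option V) => (fun w => if G.Adj (some v) o then arcMat v o w else 0 : V → ℝ))
  have h2 : (Matrix.of fun v w => ∑ o : Option V, if G.Adj (some v) o then arcMat v o w else 0).det
      = ∑ f : V → Option V, (Matrix.of fun v w =>
        if G.Adj (some v) (f v) then arcMat v (f v) w else 0).det := by
    refine Eq.trans ?_ h1
    refine congrArg Matrix.det ?_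
    ext v w
    simp [Finset.sum_apply]
  rw [h2, Nat.card_eq_fintype_card, Fintype.card_subtype, Finset.card_filter, Nat.cast_sum]
  refine Finset.sum_congr rfl fun f _ => ?_
  by_cases ha : ∀ v, G.Adj (some v) (f v)
  · simp only [ha, if_true, implies_true, true_and]
    by_cases hr : Rooted f
    · simp [hr, det_arc_rooted f hr]
    · simp [hr, det_arc_not_rooted f hr]
  · rw [if_neg (fun h => ha h.1)]
    push Not at ha
    obtain ⟨v, hv⟩ := ha
    rw [Nat.cast_zero]
    exact Matrix.det_eq_zero_of_row_eq_zero v (by simp [hv])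

lemma parentGraph_adj_some {V : Type*} (f : V → Option V) (hf : Rooted f) (v : V) :
    (parentGraph f).Adj (some v) (f v) := by
  obtain ⟨d, hd⟩ := hf
  rw [parentGraph, SimpleGraph.fromRel_adj]
  refine ⟨fun h => ?_, Or.inl ⟨v, rfl, rfl⟩⟩
  have := hd v
  rw [← h] at this
  omega

lemma parentGraph_isTree {V : Type*} [Finite V] (f : V → Option V) (hf : Rooted f) :
    (parentGraph f).IsTree := by
  have hc : (parentGraph f).Connected := by
    rw [SimpleGraph.connected_iff_exists_forall_reachable]
    refine ⟨none, ?_⟩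
    obtain ⟨d, hd⟩ := id hf
    suffices h : ∀ n o, d o = n → (parentGraph f).Reachable none o from fun o => h _ o rfl
    intro n
    induction n using Nat.strong_induction_on with
    | _ n ih =>
      intro o ho
      cases o with
      | none => exact SimpleGraph.Reachable.refl _
      | some v =>
        exact (ih _ (ho ▸ hd v) _ rfl).trans (parentGraph_adj_some f hf v).symm.reachable
  rw [SimpleGraph.isTree_iff_connected_and_card]
  refine ⟨hc, le_antisymm ?_ hc.card_vert_le_card_edgeSet_add_one⟩
  have : Nat.card (parentGraph f).edgeSet ≤ Nat.card V := by
    apply Nat.card_le_card_of_surjective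
      (fun v => (⟨s(some v, f v), parentGraph_adj_some f hf v⟩ : (parentGraph f).edgeSet))
    rintro ⟨e, he⟩
    induction e using Sym2.ind with
    | _ x y =>
      have he' : (parentGraph f).Adj x y := he
      rw [parentGraph, SimpleGraph.fromRel_adj] at he'
      rcases he'.2 with ⟨v, rfl, rfl⟩ | ⟨v, rfl, rfl⟩
      · exact ⟨v, rfl⟩
      · exact ⟨v, Subtype.ext Sym2.eq_swap⟩
  have h2 := Finite.card_option (α := V)
  omega

lemma parentGraph_injective {V : Type*} (f g : V → Option V) (hf : Rooted f)
    (h : parentGraph f = parentGraph g) : f = g := by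
  obtain ⟨d, hd⟩ := id hf
  suffices H : ∀ n v, d (some v) = n → f v = g v from funext fun v => H _ v rfl
  intro n
  induction n using Nat.strong_induction_on with
  | _ n ih =>
    intro v hv
    have ha := parentGraph_adj_some f hf v
    rw [h, parentGraph, SimpleGraph.fromRel_adj] at ha
    rcases ha.2 with ⟨w, hw, hw'⟩ | ⟨w, hw, hw'⟩
    · obtain rfl : v = w := by simpa using hw
      exact hw'
    · exfalso
      have h1 := hd v
      rw [hw] at h1
      have h2 := ih _ (hv ▸ h1) w rfl
      have h3 := hd w
      rw [h2, ← hw'] at h3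
      omega

lemma exists_parent {V : Type*} [Finite V] (T : SimpleGraph (Option V)) (hT : T.IsTree) :
    ∃ f : V → Option V, Rooted f ∧ parentGraph f = T := by
  have hstep : ∀ v : V, ∃ o, T.Adj (some v) o ∧ T.dist o none < T.dist (some v) none := by
    intro v
    obtain ⟨p, hp⟩ := hT.connected.exists_walk_length_eq_dist (some v) none
    cases p with
    | cons ha q =>
      refine ⟨_, ha, ?_⟩
      have := SimpleGraph.dist_le q
      rw [← hp, SimpleGraph.Walk.length_cons]
      omega
  choose f hf1 hf2 using hstep
  have hR : Rooted f := ⟨fun o => T.dist o none, hf2⟩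
  refine ⟨f, hR, ?_⟩
  have hle : parentGraph f ≤ T := by
    intro x y hxy
    rw [parentGraph, SimpleGraph.fromRel_adj] at hxy
    rcases hxy.2 with ⟨v, rfl, rfl⟩ | ⟨v, rfl, rfl⟩
    · exact hf1 v
    · exact (hf1 v).symm
  exact le_antisymm hle
    ((SimpleGraph.isTree_iff_minimal_connected.mp hT).2 (parentGraph_isTree f hR).connected hle)

theorem matrix_tree {V : Type*} [Fintype V] [DecidableEq V] (G : SimpleGraph (Option V))
    [DecidableRel G.Adj] :
    (numSpanningTrees G : ℝ) =
    (Matrix.of fun v w => ∑ o : Option V, if G.Adj (some v) o then arcMat v o w else 0).det := by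
  rw [det_sum_arcs, numSpanningTrees]
  congr 1
  symm
  have hle : ∀ f : V → Option V, (∀ v, G.Adj (some v) (f v)) → parentGraph f ≤ G := by
    intro f hf x y hxy
    rw [parentGraph, SimpleGraph.fromRel_adj] at hxy
    rcases hxy.2 with ⟨v, rfl, rfl⟩ | ⟨v, rfl, rfl⟩
    · exact hf v
    · exact (hf v).symm
  apply Nat.card_eq_of_bijective
    (fun f : {f : V → Option V // (∀ v, G.Adj (some v) (f v)) ∧ Rooted f} =>
      (⟨parentGraph f.1, hle f.1 f.2.1, parentGraph_isTree f.1 f.2.2⟩ :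
        {H : SimpleGraph (Option V) // H ≤ G ∧ H.IsTree}))
  constructor
  · intro f g h
    exact Subtype.ext (parentGraph_injective f.1 g.1 f.2.2 (congrArg Subtype.val h))
  · rintro ⟨T, hTG, hT⟩
    obtain ⟨f, hR, rfl⟩ := exists_parent T hT
    exact ⟨⟨f, fun v => hTG (parentGraph_adj_some f hR v), hR⟩, rfl⟩

/-- The cyclic shift matrix. -/
noncomputable def shiftMat (n : ℕ) : Matrix (Fin (n + 1)) (Fin (n + 1)) ℝ :=
  Matrix.of fun i j => if j = i + 1 then 1 else 0

lemma det_sub_shift (m : ℕ) (z : ℝ) :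
    (z • (1 : Matrix (Fin (m + 2)) (Fin (m + 2)) ℝ) - shiftMat (m + 1)).det = z ^ (m + 2) - 1 := by
  set A := z • (1 : Matrix (Fin (m + 2)) (Fin (m + 2)) ℝ) - shiftMat (m + 1) with hA
  have hAe : ∀ i j, A i j = (if i.val = j.val then z else 0) -
      (if j.val = i.val + 1 ∨ (i.val = m + 1 ∧ j.val = 0) then 1 else 0) := by
    intro i j
    have h1 : (j = i + 1) ↔ (j.val = i.val + 1 ∨ (i.val = m + 1 ∧ j.val = 0)) := by
      rw [Fin.ext_iff, Fin.val_add_one]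
      have := i.isLt
      have := j.isLt
      split_ifs with h
      · rw [Fin.ext_iff] at h
        simp at h
        omega
      · rw [Fin.ext_iff] at h
        simp at h
        omega
    simp only [hA, shiftMat, Matrix.sub_apply, Matrix.smul_apply, Matrix.one_apply, Matrix.of_apply, h1,
      smul_eq_mul, mul_ite, mul_one, mul_zero]
    simp only [Fin.ext_iff]
  rw [Matrix.det_succ_column_zero, Fin.sum_univ_succ, Fin.sum_univ_castSucc]
  have hz : ∑ i : Fin m, (-1 : ℝ) ^ ((Fin.succ (Fin.castSucc i) : Fin (m + 2)) : ℕ) *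
      A (Fin.succ (Fin.castSucc i)) 0 *
      (A.submatrix (Fin.succ (Fin.castSucc i)).succAbove Fin.succ).det = 0 := by
    apply Finset.sum_eq_zero
    intro i _
    have : A (Fin.succ (Fin.castSucc i)) 0 = 0 := by
      rw [hAe]
      have := i.isLt
      simp
      omega
    rw [this]
    ring
  have h0 : (A.submatrix (Fin.succAbove 0) Fin.succ).det = z ^ (m + 1) := by
    rw [Matrix.det_of_isUpperTriangular]
    · simp [hAe]
    · intro i j hij
      have : j.val < i.val := hij
      rw [Matrix.submatrix_apply, hAe]
      simp
      rw [if_neg (by omega), if_neg (by omega)]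
      simp
  have h1 : (A.submatrix (Fin.succAbove (Fin.succ (Fin.last m))) Fin.succ).det
      = (-1) ^ (m + 1) := by
    rw [Fin.succ_last, Fin.succAbove_last, Matrix.det_of_isLowerTriangular]
    · simp [hAe]
    · intro i j hij
      have : i.val < j.val := hij
      rw [Matrix.submatrix_apply, hAe]
      simp
      rw [if_neg (by omega), if_neg (by omega)]
      simp
  rw [hz, h0, h1, hAe, hAe]
  simp
  rw [← pow_add, show m + 1 + (m + 1) = 2 * (m + 1) by ring, pow_mul]
  simp
  ring

lemma shift_mul_transpose (m : ℕ) : shiftMat (m + 1) * (shiftMat (m + 1)).transpose = 1 := by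
  ext i j
  simp [shiftMat, Matrix.mul_apply, Matrix.one_apply, eq_comm]

lemma cheb_eval (z : ℝ) (hz : z ≠ 0) (n : ℕ) :
    (Polynomial.Chebyshev.T ℝ (n : ℤ)).eval ((z + z⁻¹) / 2) = (z ^ n + (z ^ n)⁻¹) / 2 := by
  induction n using Nat.twoStepInduction with
  | zero => simp
  | one => simp
  | more n h0 h1 =>
    push_cast at *
    rw [Polynomial.Chebyshev.T_add_two]
    simp [h0, h1]
    field_simp
    ring

lemma det_cycle (m : ℕ) (x : ℝ) (hx : 1 ≤ x) :
    ((2 * x) • (1 : Matrix (Fin (m + 2)) (Fin (m + 2)) ℝ) -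
      (shiftMat (m + 1) + (shiftMat (m + 1)).transpose)).det =
    2 * ((Polynomial.Chebyshev.T ℝ ((m + 2 : ℕ) : ℤ)).eval x - 1) := by
  obtain ⟨z, hz, hzx⟩ : ∃ z : ℝ, z ≠ 0 ∧ x = (z + z⁻¹) / 2 := by
    have hs := Real.sq_sqrt (show 0 ≤ x ^ 2 - 1 by nlinarith)
    have hp := Real.sqrt_nonneg (x ^ 2 - 1)
    refine ⟨x + √(x ^ 2 - 1), by positivity, ?_⟩
    have : x + √(x ^ 2 - 1) ≠ 0 := by positivity
    field_simp
    nlinarith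
  set Q := shiftMat (m + 1) with hQ
  have hfac : (2 * x) • (1 : Matrix (Fin (m + 2)) (Fin (m + 2)) ℝ) - (Q + Q.transpose) =
      z⁻¹ • ((z • 1 - Q) * (z • 1 - Q).transpose) := by
    have : Q * Q.transpose = 1 := shift_mul_transpose m
    rw [Matrix.transpose_sub, Matrix.transpose_smul, Matrix.transpose_one, sub_mul, mul_sub, mul_sub,
      this, hzx]
    ext i j
    simp [Matrix.sub_apply]
    field_simp
    ring
  rw [hfac, Matrix.det_smul, Matrix.det_mul, Matrix.det_transpose, hQ, det_sub_shift, hzx,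
    cheb_eval z hz, Fintype.card_fin, inv_pow]
  have : z ^ (m + 2) ≠ 0 := pow_ne_zero _ hz
  field_simp
  ring

lemma det_block {ι : Type*} [Fintype ι] [DecidableEq ι] (B : Matrix ι ι ℝ) :
    (Matrix.fromBlocks B (-1) (-1) B).det = (B + 1).det * (B - 1).det := by
  have h : Matrix.fromBlocks (1 : Matrix ι ι ℝ) 0 1 1 * Matrix.fromBlocks B (-1) (-1) B *
      Matrix.fromBlocks 1 0 (-1) 1 = Matrix.fromBlocks (B + 1) (-1) 0 (B - 1) := by
    simp [Matrix.fromBlocks_multiply, sub_eq_add_neg, add_comm]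
    abel
  have := congrArg Matrix.det h
  rw [Matrix.det_mul, Matrix.det_mul, Matrix.det_fromBlocks_zero₁₂, Matrix.det_fromBlocks_zero₁₂,
    Matrix.det_fromBlocks_zero₂₁] at this
  simpa using this

lemma prism_adj_ind (m : ℕ) (i j : Fin (m + 3)) (a b : Fin 2) [Decidable ((prism (m + 3)).Adj (i, a) (j, b))] :
    (if (prism (m + 3)).Adj (i, a) (j, b) then (1 : ℝ) else 0) =
      (if a = b then (shiftMat (m + 2) + (shiftMat (m + 2)).transpose) i j else 0) +
      (if i = j then (if a = b then 0 else 1) else 0) := by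
  have hadj : (prism (m + 3)).Adj (i, a) (j, b) ↔
      ((j = i + 1 ∨ i = j + 1) ∧ a = b) ∨ (a ≠ b ∧ i = j) := by
    rw [prism, SimpleGraph.boxProd_adj, cycleGraph_adj, sub_eq_iff_eq_add, sub_eq_iff_eq_add]
    simp only [SimpleGraph.top_adj, add_comm (1 : Fin (m + 1 + 2))]
    tauto
  have h1 : i ≠ i + 1 := by
    intro h
    have : (0 : Fin (m + 3)) = 1 := add_left_cancel ((add_zero i).trans h)
    exact absurd this (by simp)
  have h2 : ¬ (j = i + 1 ∧ i = j + 1) := by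
    rintro ⟨h, h'⟩
    rw [h, add_assoc] at h'
    have : (0 : Fin (m + 3)) = 1 + 1 := add_left_cancel ((add_zero i).trans h')
    rw [Fin.ext_iff, Fin.val_add] at this
    simp at this
    rw [Nat.mod_eq_of_lt (by omega)] at this
    omega
  by_cases hab : a = b
  · subst hab
    by_cases hj : j = i + 1
    · have : i ≠ j + 1 := fun h => h2 ⟨hj, h⟩
      rw [if_pos (hadj.2 (Or.inl ⟨Or.inl hj, rfl⟩))]
      simp [shiftMat, ← hj, this]
    · by_cases hi : i = j + 1
      · rw [if_pos (hadj.2 (Or.inl ⟨Or.inr hi, rfl⟩))]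
        simp [shiftMat, hj, ← hi]
      · rw [if_neg (by rw [hadj]; tauto)]
        simp [shiftMat, hj, hi]
  · by_cases hij : i = j
    · rw [if_pos (hadj.2 (Or.inr ⟨hab, hij⟩))]
      simp [hab, hij]
    · rw [if_neg (by rw [hadj]; tauto)]
      simp [hab, hij]

/-- Two copies of `ι` as a product. -/
def copies (ι : Type*) : ι ⊕ ι ≃ ι × Fin 2 where
  toFun := Sum.elim (fun i => (i, 0)) (fun i => (i, 1))
  invFun p := if p.2 = 0 then Sum.inl p.1 else Sum.inr p.1
  left_inv := by rintro (i | i) <;> simp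
  right_inv := by
    rintro ⟨i, a⟩
    fin_cases a <;> simp

theorem numSpanningTrees_cone_prism (n : ℕ) (hn : 3 ≤ n) :
    (numSpanningTrees (cone (prism n)) : ℝ) =
      4 * ((Polynomial.Chebyshev.T ℝ (n : ℤ)).eval (3 / 2 : ℝ) - 1) *
        ((Polynomial.Chebyshev.T ℝ (n : ℤ)).eval (5 / 2 : ℝ) - 1) := by
  classical
  obtain ⟨m, rfl⟩ := Nat.exists_eq_add_of_le' hn
  rw [matrix_tree]
  set Q := shiftMat (m + 2) with hQ
  have hsum : ∀ v : Fin (m + 3) × Fin 2, ∑ u, (if (prism (m + 3)).Adj v u then (1 : ℝ) else 0) = 3 := by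
    rintro ⟨i, a⟩
    rw [Fintype.sum_prod_type]
    simp only [prism_adj_ind]
    simp only [Finset.sum_add_distrib, Fin.sum_univ_two]
    have h1 : ∑ j, Q i j = 1 := by simp [hQ, shiftMat]
    have h2 : ∑ j, Q j i = 1 := by
      have : ∀ j : Fin (m + 3), i = j + 1 ↔ j = i - 1 := fun j => by
        rw [eq_sub_iff_add_eq, eq_comm]
      simp [hQ, shiftMat, this]
    rw [← hQ]
    fin_cases a <;> simp [Finset.sum_add_distrib, h1, h2] <;> norm_num
  have hentry : ∀ v w : Fin (m + 3) × Fin 2,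
      (∑ o : Option (Fin (m + 3) × Fin 2),
        if (cone (prism (m + 3))).Adj (some v) o then arcMat v o w else 0) =
      (if w = v then 4 else 0) - (if (prism (m + 3)).Adj v w then 1 else 0) := by
    intro v w
    have hn : (cone (prism (m + 3))).Adj (some v) none := by simp [cone]
    have hs : ∀ u, (cone (prism (m + 3))).Adj (some v) (some u) ↔ (prism (m + 3)).Adj v u := by
      intro u
      simp only [cone, SimpleGraph.fromRel_adj]
      constructor
      · rintro ⟨_, h⟩
        simpa [SimpleGraph.adj_comm] using h
      · intro h
        exact ⟨by simpa using h.ne, Or.inl (Or.inr ⟨v, u, rfl, rfl, h⟩)⟩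
    rw [Fintype.sum_option]
    simp only [hn, hs, if_true]
    have : ∀ u, (if (prism (m + 3)).Adj v u then arcMat v (some u) w else 0) =
        (if w = v then 1 else 0) * (if (prism (m + 3)).Adj v u then (1 : ℝ) else 0) -
        (if u = w then (if (prism (m + 3)).Adj v u then (1 : ℝ) else 0) else 0) := by
      intro u
      by_cases h : (prism (m + 3)).Adj v u <;> simp [h, arcMat]
    simp only [this, Finset.sum_sub_distrib, ← Finset.mul_sum, hsum]
    simp only [arcMat, Finset.sum_ite_eq', Finset.mem_univ, if_true]
    by_cases h : w = v <;> simp [h] <;> norm_num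
  have hB : (Matrix.of fun v w => ∑ o : Option (Fin (m + 3) × Fin 2),
        if (cone (prism (m + 3))).Adj (some v) o then arcMat v o w else 0).submatrix
        (copies _) (copies _) =
      Matrix.fromBlocks ((4 : ℝ) • 1 - (Q + Q.transpose)) (-1) (-1)
        ((4 : ℝ) • 1 - (Q + Q.transpose)) := by
    have hl : ∀ i : Fin (m + 3), copies _ (Sum.inl i) = (i, 0) := fun _ => rfl
    have hr : ∀ i : Fin (m + 3), copies _ (Sum.inr i) = (i, 1) := fun _ => rfl
    ext (i | i) (j | j) <;>
      rw [Matrix.submatrix_apply, Matrix.of_apply] <;>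
      simp only [hl, hr] <;>
      rw [hentry, prism_adj_ind] <;>
      simp [Matrix.one_apply, hQ, eq_comm]
  rw [← Matrix.det_submatrix_equiv_self (copies _), hB, det_block]
  have h5 := det_cycle (m + 1) (5 / 2) (by norm_num)
  have h3 := det_cycle (m + 1) (3 / 2) (by norm_num)
  have e5 : (4 : ℝ) • 1 - (Q + Q.transpose) + 1 = (2 * (5 / 2 : ℝ)) • 1 - (Q + Q.transpose) := by
    rw [show (2 * (5 / 2 : ℝ)) = 4 + 1 by norm_num, add_smul, one_smul]
    abel
  have e3 : (4 : ℝ) • 1 - (Q + Q.transpose) - 1 = (2 * (3 / 2 : ℝ)) • 1 - (Q + Q.transpose) := by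
    rw [show (2 * (3 / 2 : ℝ)) = 4 - 1 by norm_num, sub_smul, one_smul]
    abel
  rw [e5, e3, hQ, h5, h3]
  ring
end
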